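/- arXiv:2306.15441 — 6 statements merged into one kernel-verified Lean document; each statement's English description precedes it below -/
import Mathlib

section
/- Let p be a prime. Inside the 2×2 matrices over ℚ_p, the double coset GL₂(ℤ_p)·D·GL₂(ℤ_p) = {γ₁·D·γ₂ : γ₁, γ₂ ∈ GL₂(ℤ_p)}, where D = [[1,0],[0,p]], equals the union of the left cosets h_c·GL₂(ℤ_p) for c = 0, 1, …, p−1 together with the left coset D'·GL₂(ℤ_p), where h_c = [[1,0],[c,p]] and D' = [[p,0],[0,1]], and these p+1 cosets are pairwise disjoint. -/
open Matrix

/-- `GL₂(ℤ_p)`: invertible `2×2` matrices over `ℤ_p` (entries of norm `≤ 1` and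
determinant a unit of `ℤ_p`), viewed as a set of `2×2` matrices over `ℚ_p`. -/
def GL2Zp (p : ℕ) [Fact p.Prime] : Set (Matrix (Fin 2) (Fin 2) ℚ_[p]) :=
  { g | (∀ i j, ‖g i j‖ ≤ 1) ∧ ‖g.det‖ = 1 }

/-- `GL₂(ℤ_p)` consists of the matrices with entries `a b c d : ℤ_p` and `a d - b c` a unit. -/
theorem mem_GL2Zp_iff {p : ℕ} [Fact p.Prime] {g : Matrix (Fin 2) (Fin 2) ℚ_[p]} :
    g ∈ GL2Zp p ↔ ∃ a b c d : ℤ_[p], IsUnit (a * d - b * c) ∧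
      g = !![(a : ℚ_[p]), (b : ℚ_[p]); (c : ℚ_[p]), (d : ℚ_[p])] := by
  constructor
  · rintro ⟨h, hdet⟩
    refine ⟨⟨g 0 0, h 0 0⟩, ⟨g 0 1, h 0 1⟩, ⟨g 1 0, h 1 0⟩, ⟨g 1 1, h 1 1⟩, ?_,
      Matrix.eta_fin_two g⟩
    rw [PadicInt.isUnit_iff, PadicInt.norm_def]
    rwa [Matrix.det_fin_two] at hdet
  · rintro ⟨a, b, c, d, hu, rfl⟩
    rw [PadicInt.isUnit_iff, PadicInt.norm_def] at hu
    refine ⟨fun i j => ?_, by simpa [Matrix.det_fin_two] using hu⟩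
    fin_cases i <;> fin_cases j <;> exact PadicInt.norm_le_one _

theorem mul_mem_GL2Zp {p : ℕ} [Fact p.Prime] {g h : Matrix (Fin 2) (Fin 2) ℚ_[p]}
    (hg : g ∈ GL2Zp p) (hh : h ∈ GL2Zp p) : g * h ∈ GL2Zp p := by
  obtain ⟨a, b, c, d, hu, rfl⟩ := mem_GL2Zp_iff.1 hg
  obtain ⟨a', b', c', d', hu', rfl⟩ := mem_GL2Zp_iff.1 hh
  refine mem_GL2Zp_iff.2 ⟨a * a' + b * c', a * b' + b * d', c * a' + d * c', c * b' + d * d',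
    ?_, by simp⟩
  convert hu.mul hu' using 1
  ring

theorem PadicInt.isUnit_or_dvd {p : ℕ} [Fact p.Prime] (a : ℤ_[p]) :
    IsUnit a ∨ (p : ℤ_[p]) ∣ a := by
  rw [← PadicInt.norm_lt_one_iff_dvd, PadicInt.isUnit_iff]
  exact (PadicInt.norm_le_one a).eq_or_lt

/-- The two entries of the first row of an element of `GL₂(ℤ_p)` are not both divisible by `p`. -/
theorem not_isUnit_of_dvd_row {p : ℕ} [Fact p.Prime] {a b c d : ℤ_[p]}
    (ha : (p : ℤ_[p]) ∣ a) (hb : (p : ℤ_[p]) ∣ b) : ¬ IsUnit (a * d - b * c) := fun hu =>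
  PadicInt.prime_p.not_isUnit <| isUnit_of_dvd_unit ((ha.mul_right d).sub (hb.mul_right c)) hu

/-- Every `γ · diag(1, p)` with `γ ∈ GL₂(ℤ_p)` lies in one of the `p + 1` left cosets. -/
theorem GL2Zp_mul_diag {p : ℕ} [Fact p.Prime] {g : Matrix (Fin 2) (Fin 2) ℚ_[p]}
    (hg : g ∈ GL2Zp p) :
    (∃ n ∈ Finset.range p, ∃ x ∈ GL2Zp p, g * !![1, 0; 0, (p : ℚ_[p])] =
        !![1, 0; (n : ℚ_[p]), (p : ℚ_[p])] * x) ∨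
      ∃ x ∈ GL2Zp p, g * !![1, 0; 0, (p : ℚ_[p])] = !![(p : ℚ_[p]), 0; 0, 1] * x := by
  obtain ⟨a, b, c, d, hu, rfl⟩ := mem_GL2Zp_iff.1 hg
  rcases PadicInt.isUnit_or_dvd a with ⟨u, rfl⟩ | ⟨e, rfl⟩
  · left
    obtain ⟨n, hn, hmem⟩ := PadicInt.exists_mem_range (c * (↑u⁻¹ : ℤ_[p]))
    rw [PadicInt.maximalIdeal_eq_span_p, Ideal.mem_span_singleton] at hmem
    obtain ⟨e, he⟩ := hmem
    have hc : c = n * u + p * (e * u) := by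
      linear_combination (u : ℤ_[p]) * he - c * u.inv_mul
    refine ⟨n, Finset.mem_range.2 hn, _,
      mem_GL2Zp_iff.2 ⟨u, p * b, e * u, d - n * b, ?_, rfl⟩, ?_⟩
    · convert hu using 1
      rw [hc]
      ring
    · rw [hc]
      ext i j
      fin_cases i <;> fin_cases j <;> simp <;> ring
  · right
    refine ⟨_, mem_GL2Zp_iff.2 ⟨e, b, c, p * d, ?_, rfl⟩, ?_⟩
    · convert hu using 1
      ring
    · ext i j
      fin_cases i <;> fin_cases j <;> simp <;> ring

/-- Natural numbers below `p` that are congruent modulo `p` in `ℤ_p` are equal. -/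
theorem PadicInt.eq_of_dvd_natCast_sub {p : ℕ} [Fact p.Prime] {m n : ℕ} (hm : m < p) (hn : n < p)
    (h : (p : ℤ_[p]) ∣ (m : ℤ_[p]) - n) : m = n := by
  have h' : (p : ℤ) ∣ (n : ℤ) - m := by
    rw [← PadicInt.norm_lt_one_iff_dvd] at h
    rw [← PadicInt.norm_int_lt_one_iff_dvd, ← norm_neg]
    simpa using h
  exact Nat.ModEq.eq_of_lt_of_lt (Nat.modEq_iff_dvd.2 h') hm hn


/-- The double coset `GL₂(ℤ_p)·D·GL₂(ℤ_p)`, where `D = [[1,0],[0,p]]`, is the disjoint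
union of the left cosets `[[1,0],[c,p]]·GL₂(ℤ_p)` for `c = 0, …, p−1` together with
`[[p,0],[0,1]]·GL₂(ℤ_p)`. -/
theorem stmt_1 (p : ℕ) [Fact p.Prime] :
    ({ m : Matrix (Fin 2) (Fin 2) ℚ_[p] |
        ∃ γ₁ ∈ GL2Zp p, ∃ γ₂ ∈ GL2Zp p,
          m = γ₁ * !![1, 0; 0, (p : ℚ_[p])] * γ₂ } =
      (⋃ c ∈ Finset.range p,
        (fun x => !![1, 0; (c : ℚ_[p]), (p : ℚ_[p])] * x) '' GL2Zp p) ∪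
        (fun x => !![(p : ℚ_[p]), 0; 0, 1] * x) '' GL2Zp p) ∧
    (∀ c ∈ Finset.range p, ∀ c' ∈ Finset.range p, c ≠ c' →
      Disjoint
        ((fun x => !![1, 0; (c : ℚ_[p]), (p : ℚ_[p])] * x) '' GL2Zp p)
        ((fun x => !![1, 0; (c' : ℚ_[p]), (p : ℚ_[p])] * x) '' GL2Zp p)) ∧
    (∀ c ∈ Finset.range p,
      Disjoint
        ((fun x => !![1, 0; (c : ℚ_[p]), (p : ℚ_[p])] * x) '' GL2Zp p)
        ((fun x => !![(p : ℚ_[p]), 0; 0, 1] * x) '' GL2Zp p)) := by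
  refine ⟨?_, ?_, ?_⟩
  · ext m
    simp only [Set.mem_ofPred_eq, Set.mem_union, Set.mem_iUnion, Set.mem_image, exists_prop]
    constructor
    · rintro ⟨g, hg, h, hh, rfl⟩
      rcases GL2Zp_mul_diag hg with ⟨n, hn, x, hx, e⟩ | ⟨x, hx, e⟩
      · exact Or.inl ⟨n, hn, x * h, mul_mem_GL2Zp hx hh, by rw [e, Matrix.mul_assoc]⟩
      · exact Or.inr ⟨x * h, mul_mem_GL2Zp hx hh, by rw [e, Matrix.mul_assoc]⟩
    · rintro (⟨n, -, x, hx, rfl⟩ | ⟨x, hx, rfl⟩)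
      · exact ⟨_, mem_GL2Zp_iff.2 ⟨1, 0, n, 1, by simp, rfl⟩, x, hx, by simp⟩
      · have hw : !![0, 1; 1, 0] ∈ GL2Zp p := mem_GL2Zp_iff.2 ⟨0, 1, 1, 0, by simp, by simp⟩
        exact ⟨_, hw, _, mul_mem_GL2Zp hw hx, by
          rw [← Matrix.mul_assoc]
          congr 1
          simp⟩
  · intro m hm n hn hmn
    rw [Set.disjoint_left]
    rintro _ ⟨x, hx, rfl⟩ ⟨y, hy, hxy⟩
    obtain ⟨a, b, c, d, hu, rfl⟩ := mem_GL2Zp_iff.1 hx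
    obtain ⟨a', b', c', d', -, rfl⟩ := mem_GL2Zp_iff.1 hy
    have key : ∀ s t t' : ℤ_[p], (n : ℤ_[p]) * s + p * t' = m * s + p * t → (p : ℤ_[p]) ∣ s := by
      intro s t t' h
      have hdvd : (p : ℤ_[p]) ∣ ((m : ℤ_[p]) - n) * s := ⟨t' - t, by linear_combination -h⟩
      exact (PadicInt.prime_p.dvd_or_dvd hdvd).resolve_left fun h' =>
        hmn (PadicInt.eq_of_dvd_natCast_sub (Finset.mem_range.1 hm) (Finset.mem_range.1 hn) h')
    simp at hxy
    norm_cast at hxy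
    obtain ⟨⟨ha, hb⟩, h1, h2⟩ := hxy
    obtain rfl := PadicInt.ext ha
    obtain rfl := PadicInt.ext hb
    exact not_isUnit_of_dvd_row (key _ _ _ (PadicInt.ext h1)) (key _ _ _ (PadicInt.ext h2)) hu
  · intro n hn
    rw [Set.disjoint_left]
    rintro _ ⟨x, hx, rfl⟩ ⟨y, hy, hxy⟩
    obtain ⟨a, b, c, d, hu, rfl⟩ := mem_GL2Zp_iff.1 hx
    obtain ⟨a', b', c', d', -, rfl⟩ := mem_GL2Zp_iff.1 hy
    simp at hxy
    norm_cast at hxy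
    obtain ⟨⟨h1, h2⟩, -⟩ := hxy
    exact not_isUnit_of_dvd_row ⟨_, (PadicInt.ext h1).symm⟩ ⟨_, (PadicInt.ext h2).symm⟩ hu
end

section
/- Let p be a prime, let D = [[1,0],[0,p]] (viewed in GL₂(ℚ_p)), and set Γ' = (D·Γ₀(p)·D⁻¹) ∩ Γ₀(p). Then Γ' = {γ ∈ Γ₀(p) : the lower-left entry of γ lies in p²ℤ_p}, and the matrices u_c = [[1,0],[p·c,1]] for c = 0, 1, …, p−1 form a complete set of left coset representatives of Γ' in Γ₀(p); that is, Γ₀(p) is the disjoint union of the cosets u_c·Γ' for c = 0, 1, …, p−1. -/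
open Matrix

/-- The subgroup `Γ₀(p)` of `GL₂(ℤ_p)`: invertible `2×2` matrices over `ℤ_p`
(entries of norm `≤ 1`, determinant a unit) whose lower-left entry lies in `pℤ_p`,
viewed as a set of `2×2` matrices over `ℚ_p`. -/
def Gamma0 (p : ℕ) [Fact p.Prime] : Set (Matrix (Fin 2) (Fin 2) ℚ_[p]) :=
  { g | (∀ i j, ‖g i j‖ ≤ 1) ∧ ‖g.det‖ = 1 ∧
      ∃ y : ℚ_[p], ‖y‖ ≤ 1 ∧ g 1 0 = (p : ℚ_[p]) * y }

/-- `Γ' = (D·Γ₀(p)·D⁻¹) ∩ Γ₀(p)` where `D = [[1,0],[0,p]]` is viewed in `GL₂(ℚ_p)`. -/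
noncomputable def GammaPrime (p : ℕ) [Fact p.Prime] : Set (Matrix (Fin 2) (Fin 2) ℚ_[p]) :=
  ((fun γ => !![1, 0; 0, (p : ℚ_[p])] * γ * (!![1, 0; 0, (p : ℚ_[p])])⁻¹) '' Gamma0 p) ∩
    Gamma0 p

theorem PadicInt.isUnit_add_p_mul_iff {p : ℕ} [Fact p.Prime] (x y : ℤ_[p]) :
    IsUnit (x + p * y) ↔ IsUnit x := by
  have hy : (p : ℤ_[p]) * y ∈ IsLocalRing.maximalIdeal ℤ_[p] := by
    rw [PadicInt.maximalIdeal_eq_span_p]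
    exact Ideal.mul_mem_right _ _ (Ideal.mem_span_singleton_self _)
  rw [← not_iff_not, ← mem_nonunits_iff, ← mem_nonunits_iff,
    ← IsLocalRing.mem_maximalIdeal, ← IsLocalRing.mem_maximalIdeal]
  exact Ideal.add_mem_iff_left _ hy

/-- The elements of `Γ₀(p)` are the matrices `[[a,b],[pc,d]]` with `a`, `d` units of `ℤ_p`. -/
theorem mem_Gamma0_iff {p : ℕ} [Fact p.Prime] {g : Matrix (Fin 2) (Fin 2) ℚ_[p]} :
    g ∈ Gamma0 p ↔ ∃ a b c d : ℤ_[p], IsUnit a ∧ IsUnit d ∧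
      g = !![(a : ℚ_[p]), (b : ℚ_[p]); (p : ℚ_[p]) * (c : ℚ_[p]), (d : ℚ_[p])] := by
  have isUnit_iff (a b c d : ℤ_[p]) : IsUnit (a * d - b * (p * c)) ↔ IsUnit a ∧ IsUnit d := by
    rw [← IsUnit.mul_iff, ← PadicInt.isUnit_add_p_mul_iff (a * d) (-(b * c))]
    ring_nf
  constructor
  · rintro ⟨hg, hdet, y, hy, h10⟩
    have lift (x : ℚ_[p]) (hx : ‖x‖ ≤ 1) : ∃ z : ℤ_[p], (z : ℚ_[p]) = x := ⟨⟨x, hx⟩, rfl⟩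
    obtain ⟨a, ha⟩ := lift _ (hg 0 0)
    obtain ⟨b, hb⟩ := lift _ (hg 0 1)
    obtain ⟨c, rfl⟩ := lift _ hy
    obtain ⟨d, hd⟩ := lift _ (hg 1 1)
    rw [Matrix.det_fin_two, h10, ← ha, ← hb, ← hd] at hdet
    obtain ⟨ua, ud⟩ := (isUnit_iff a b c d).1 (PadicInt.isUnit_iff.2 (by exact_mod_cast hdet))
    refine ⟨a, b, c, d, ua, ud, ?_⟩
    rw [ha, hb, hd, ← h10]
    exact Matrix.eta_fin_two g
  · rintro ⟨a, b, c, d, ha, hd, rfl⟩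
    refine ⟨fun i j => ?_, ?_, c, c.norm_le_one, by simp⟩
    · fin_cases i <;> fin_cases j
      · exact a.norm_le_one
      · exact b.norm_le_one
      · exact_mod_cast (p * c : ℤ_[p]).norm_le_one
      · exact d.norm_le_one
    · rw [Matrix.det_fin_two_of]
      exact_mod_cast PadicInt.isUnit_iff.1 ((isUnit_iff a b c d).2 ⟨ha, hd⟩)

/-- The elements of `Γ'` are the matrices `[[a,b],[p²c,d]]` with `a`, `d` units of `ℤ_p`. -/
theorem mem_GammaPrime_iff {p : ℕ} [Fact p.Prime] {g : Matrix (Fin 2) (Fin 2) ℚ_[p]} :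
    g ∈ GammaPrime p ↔ ∃ a b c d : ℤ_[p], IsUnit a ∧ IsUnit d ∧
      g = !![(a : ℚ_[p]), (b : ℚ_[p]); (p : ℚ_[p]) ^ 2 * (c : ℚ_[p]), (d : ℚ_[p])] := by
  have hp : (p : ℚ_[p]) ≠ 0 := by exact_mod_cast (Fact.out : p.Prime).ne_zero
  have hinv : (!![1, 0; 0, (p : ℚ_[p])])⁻¹ = !![1, 0; 0, (p : ℚ_[p])⁻¹] := by
    apply Matrix.inv_eq_right_inv
    simp [Matrix.one_fin_two, hp]
  have conj (a b c d : ℚ_[p]) :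
      !![1, 0; 0, (p : ℚ_[p])] * !![a, b; c, d] * (!![1, 0; 0, (p : ℚ_[p])])⁻¹ =
        !![a, b * (p : ℚ_[p])⁻¹; p * c, d] := by
    rw [hinv]
    ext i j
    fin_cases i <;> fin_cases j <;> simp
    field_simp
  constructor
  · rintro ⟨⟨γ, hγ, rfl⟩, hg⟩
    obtain ⟨a, b, c, d, ha, hd, rfl⟩ := mem_Gamma0_iff.1 hγ
    obtain ⟨a', b', c', d', -, -, h⟩ := mem_Gamma0_iff.1 hg
    dsimp only at h ⊢
    rw [conj] at h ⊢
    have h01 : (b : ℚ_[p]) * (p : ℚ_[p])⁻¹ = b' := congrFun (congrFun h 0) 1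
    exact ⟨a, b', c, d, ha, hd, by rw [h01, pow_two, mul_assoc]⟩
  · rintro ⟨a, b, c, d, ha, hd, rfl⟩
    refine ⟨⟨_, mem_Gamma0_iff.2 ⟨a, p * b, c, d, ha, hd, rfl⟩, ?_⟩,
      mem_Gamma0_iff.2 ⟨a, b, p * c, d, ha, hd, ?_⟩⟩
    · dsimp only
      rw [conj, pow_two, mul_assoc]
      push_cast
      rw [mul_comm (p : ℚ_[p]) b, mul_inv_cancel_right₀ hp]
    · push_cast
      rw [pow_two, mul_assoc]

theorem lower_unipotent_mul {R : Type*} [CommRing R] (t a b c d : R) :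
    !![1, 0; t, 1] * !![a, b; c, d] = !![a, b; t * a + c, t * b + d] := by
  simp

/-- `Γ'` consists of the elements of `Γ₀(p)` whose lower-left entry lies in `p²ℤ_p`,
and the matrices `u_c = [[1,0],[p·c,1]]`, `c = 0, …, p−1`, form a complete set of left
coset representatives of `Γ'` in `Γ₀(p)`. -/
theorem stmt_2 (p : ℕ) [Fact p.Prime] :
    (GammaPrime p =
      { γ ∈ Gamma0 p | ∃ y : ℚ_[p], ‖y‖ ≤ 1 ∧ γ 1 0 = (p : ℚ_[p]) ^ 2 * y }) ∧
    (Gamma0 p =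
      ⋃ c ∈ Finset.range p,
        (fun x => !![1, 0; (p : ℚ_[p]) * (c : ℚ_[p]), 1] * x) '' GammaPrime p) ∧
    (∀ c ∈ Finset.range p, ∀ c' ∈ Finset.range p, c ≠ c' →
      Disjoint
        ((fun x => !![1, 0; (p : ℚ_[p]) * (c : ℚ_[p]), 1] * x) '' GammaPrime p)
        ((fun x => !![1, 0; (p : ℚ_[p]) * (c' : ℚ_[p]), 1] * x) '' GammaPrime p)) := by
  have hp : (p : ℚ_[p]) ≠ 0 := by exact_mod_cast (Fact.out : p.Prime).ne_zero
  refine ⟨?_, ?_, ?_⟩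
  · ext g
    rw [mem_GammaPrime_iff, Set.mem_sep_iff]
    constructor
    · rintro ⟨a, b, c, d, ha, hd, rfl⟩
      refine ⟨mem_Gamma0_iff.2 ⟨a, b, p * c, d, ha, hd, ?_⟩, c, c.norm_le_one, by simp⟩
      push_cast
      rw [pow_two, mul_assoc]
    · rintro ⟨hg, y, hy, h10⟩
      obtain ⟨a, b, c, d, ha, hd, rfl⟩ := mem_Gamma0_iff.1 hg
      refine ⟨a, b, ⟨y, hy⟩, d, ha, hd, ?_⟩
      have h : (p : ℚ_[p]) * c = p ^ 2 * y := h10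
      rw [h]
  · ext g
    simp only [Set.mem_iUnion, Set.mem_image, Finset.mem_range, exists_prop]
    constructor
    · intro hg
      obtain ⟨a, b, c, d, ha, hd, rfl⟩ := mem_Gamma0_iff.1 hg
      obtain ⟨u, rfl⟩ := ha
      obtain ⟨n, hn, hmem⟩ := PadicInt.exists_mem_range (p := p) (c * ↑u⁻¹)
      rw [PadicInt.maximalIdeal_eq_span_p, Ideal.mem_span_singleton] at hmem
      obtain ⟨z, hz⟩ := hmem
      have hc : c = n * u + p * (z * u) := by
        linear_combination (u : ℤ_[p]) * hz - c * u.inv_mul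
      have hd' : IsUnit (d + p * (-(n * b))) := (PadicInt.isUnit_add_p_mul_iff _ _).2 hd
      refine ⟨n, hn, _, mem_GammaPrime_iff.2 ⟨u, b, z * u, _, u.isUnit, hd', rfl⟩, ?_⟩
      rw [lower_unipotent_mul, hc]
      push_cast
      congr! 2
      ring_nf
    · rintro ⟨n, -, x, hx, rfl⟩
      obtain ⟨a, b, c, d, ha, hd, rfl⟩ := mem_GammaPrime_iff.1 hx
      refine mem_Gamma0_iff.2 ⟨a, b, n * a + p * c, d + p * (n * b), ha,
        (PadicInt.isUnit_add_p_mul_iff _ _).2 hd, ?_⟩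
      · rw [lower_unipotent_mul]
        push_cast
        congr! 2
        ring_nf
  · intro m hm n hn hmn
    rw [Set.disjoint_left]
    rintro _ ⟨x, hx, rfl⟩ ⟨x', hx', h⟩
    obtain ⟨a, b, c, d, ha, -, rfl⟩ := mem_GammaPrime_iff.1 hx
    obtain ⟨a', b', c', d', -, -, rfl⟩ := mem_GammaPrime_iff.1 hx'
    dsimp only at h
    rw [lower_unipotent_mul, lower_unipotent_mul] at h
    have h00 : (a' : ℚ_[p]) = a := congrFun (congrFun h 0) 0
    have h10 : (p : ℚ_[p]) * n * a' + p ^ 2 * c' = p * m * a + p ^ 2 * c :=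
      congrFun (congrFun h 1) 0
    have key : ((m : ℤ_[p]) - n) * a = p * (c' - c) := by
      have : (p : ℚ_[p]) * ((m - n) * a) = p * (p * (c' - c)) := by
        rw [h00] at h10
        linear_combination -h10
      apply PadicInt.ext
      push_cast
      exact mul_left_cancel₀ hp this
    have hdvd : (p : ℤ_[p]) ∣ ((m - n : ℤ) : ℤ_[p]) := by
      push_cast
      exact (ha.dvd_mul_right).1 ⟨_, key⟩
    rw [← Ideal.mem_span_singleton, ← PadicInt.maximalIdeal_eq_span_p,
      IsLocalRing.mem_maximalIdeal, PadicInt.mem_nonunits, PadicInt.norm_int_lt_one_iff_dvd] at hdvd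
    have := Int.eq_zero_of_abs_lt_dvd hdvd (by
      rw [Finset.mem_range] at hm hn
      rw [abs_lt]
      omega)
    omega
end

section
/- Let p be a prime and k a natural number. Suppose M is a 4×4 complex matrix of the form with rows (x, p^k, a, 0), (y, 0, b, 0), (z, 0, c, p^k), (t, 0, d, 0) for complex numbers x, y, z, t, a, b, c, d, and suppose M² = (−p)^k·I₄. Then x = z = t = a = b = c = 0 and y = d = (−1)^k. -/
open Matrix

/-- Uniqueness computation for the partial Atkin–Lehner matrix: if `M` has the shape
with rows `(x, p^k, a, 0)`, `(y, 0, b, 0)`, `(z, 0, c, p^k)`, `(t, 0, d, 0)` and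
`M² = (−p)^k·I₄`, then `x = z = t = a = b = c = 0` and `y = d = (−1)^k`. -/
theorem stmt_6 (p k : ℕ) (hp : p.Prime) (x y z t a b c d : ℂ)
    (hM : (!![x, (p : ℂ) ^ k, a, 0;
              y, 0, b, 0;
              z, 0, c, (p : ℂ) ^ k;
              t, 0, d, 0] : Matrix (Fin 4) (Fin 4) ℂ) *
          !![x, (p : ℂ) ^ k, a, 0;
             y, 0, b, 0;
             z, 0, c, (p : ℂ) ^ k;
             t, 0, d, 0] = (-(p : ℂ)) ^ k • (1 : Matrix (Fin 4) (Fin 4) ℂ)) :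
    x = 0 ∧ z = 0 ∧ t = 0 ∧ a = 0 ∧ b = 0 ∧ c = 0 ∧
      y = (-1 : ℂ) ^ k ∧ d = (-1 : ℂ) ^ k := by
  have hq : (p : ℂ) ^ k ≠ 0 := pow_ne_zero _ (Nat.cast_ne_zero.mpr hp.ne_zero)
  have entry (i j : Fin 4) := congrFun (congrFun hM i) j
  have h01 := entry 0 1
  have h03 := entry 0 3
  have h11 := entry 1 1
  have h13 := entry 1 3
  have h21 := entry 2 1
  have h23 := entry 2 3
  have h31 := entry 3 1
  have h33 := entry 3 3
  rw [neg_pow] at h11 h33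
  simp [Matrix.mul_apply, Fin.sum_univ_four, -mul_eq_zero, -mul_eq_mul_right_iff]
    at h01 h03 h11 h13 h21 h23 h31 h33
  have cancel {u : ℂ} (h : u * (p : ℂ) ^ k = 0) : u = 0 :=
    (mul_eq_zero.mp h).resolve_right hq
  exact ⟨cancel h01, cancel h21, cancel h31, cancel h03, cancel h13, cancel h23,
    mul_right_cancel₀ hq h11, mul_right_cancel₀ hq h33⟩
end

section
/- Set ω_p = ω𝔭·ω𝔭̄. Then the following three conjugation identities hold: U𝔭·ω_p = ω_p·U𝔭*, U𝔭̄·ω_p = ω_p·U𝔭̄*, and (U𝔭·U𝔭̄)·ω_p = ω_p·U_p*, where U𝔭* is the 4×4 matrix with rows (0, −(−p)^k, 0, 0), ((−1)^k·p, λ𝔭, 0, 0), (0, 0, 0, −(−p)^k), (0, 0, (−1)^k·p, λ𝔭); U𝔭̄* is the matrix with rows (0, 0, −(−p)^k, 0), (0, 0, 0, −(−p)^k), ((−1)^k·p, 0, λ𝔭̄, 0), (0, (−1)^k·p, 0, λ𝔭̄); and U_p* is the matrix with rows (0, 0, 0, p^{2k}), (0, 0, −p^{k+1}, (−1)^{k+1}p^kλ𝔭),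 (0, −p^{k+1}, 0, (−1)^{k+1}p^kλ𝔭̄), (p², (−1)^k·pλ𝔭, (−1)^k·pλ𝔭̄, λ𝔭λ𝔭̄). Since ω_p is invertible, equivalently ω_p⁻¹·U𝔭·ω_p = U𝔭*, ω_p⁻¹·U𝔭̄·ω_p = U𝔭̄*, and ω_p⁻¹·(U𝔭·U𝔭̄)·ω_p = U_p*. -/
open Matrix

/-- The matrix of the Hecke operator `U𝔭` in the basis
`[μ], υ𝔭*·[μ], υ𝔭̄*·[μ], υ𝔭*υ𝔭̄*·[μ]`. -/
noncomputable def Ufp (p k : ℕ) (lp : ℂ) : Matrix (Fin 4) (Fin 4) ℂ :=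
  !![lp, (p : ℂ) ^ (k + 1), 0, 0;
     -1, 0, 0, 0;
     0, 0, lp, (p : ℂ) ^ (k + 1);
     0, 0, -1, 0]

/-- The matrix of the Hecke operator `U𝔭̄` in the same basis. -/
noncomputable def Ufpb (p k : ℕ) (lpb : ℂ) : Matrix (Fin 4) (Fin 4) ℂ :=
  !![lpb, 0, (p : ℂ) ^ (k + 1), 0;
     0, lpb, 0, (p : ℂ) ^ (k + 1);
     -1, 0, 0, 0;
     0, -1, 0, 0]

/-- The matrix of the partial Atkin–Lehner operator `ω𝔭` (with `ε = (−1)^k`). -/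
noncomputable def Wfp (p k : ℕ) : Matrix (Fin 4) (Fin 4) ℂ :=
  !![0, (p : ℂ) ^ k, 0, 0;
     (-1 : ℂ) ^ k, 0, 0, 0;
     0, 0, 0, (p : ℂ) ^ k;
     0, 0, (-1 : ℂ) ^ k, 0]

/-- The matrix of the partial Atkin–Lehner operator `ω𝔭̄` (with `ε = (−1)^k`). -/
noncomputable def Wfpb (p k : ℕ) : Matrix (Fin 4) (Fin 4) ℂ :=
  !![0, 0, (p : ℂ) ^ k, 0;
     0, 0, 0, (p : ℂ) ^ k;
     (-1 : ℂ) ^ k, 0, 0, 0;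
     0, (-1 : ℂ) ^ k, 0, 0]

/-- The Atkin–Lehner matrix `ω_p = ω𝔭·ω𝔭̄`. -/
noncomputable def Wp (p k : ℕ) : Matrix (Fin 4) (Fin 4) ℂ := Wfp p k * Wfpb p k

/-- The Atkin–Lehner matrix `ω_p` is antidiagonal. -/
lemma Wp_eq (p k : ℕ) :
    Wp p k =
      !![0, 0, 0, (p : ℂ) ^ k * (p : ℂ) ^ k;
         0, 0, (-1 : ℂ) ^ k * (p : ℂ) ^ k, 0;
         0, (-1 : ℂ) ^ k * (p : ℂ) ^ k, 0, 0;
         1, 0, 0, 0] := by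
  ext i j
  fin_cases i <;> fin_cases j <;>
    simp [Wp, Wfp, Wfpb, Matrix.mul_apply, Fin.sum_univ_four, mul_comm, ← mul_pow]

lemma neg_one_pow_mul_self (k : ℕ) : (-1 : ℂ) ^ k * (-1 : ℂ) ^ k = 1 := by
  simp [← mul_pow]

lemma isUnit_Wp (p k : ℕ) (hp : p.Prime) : IsUnit (Wp p k) := by
  have h0 : (p : ℂ) ≠ 0 := Nat.cast_ne_zero.mpr hp.ne_zero
  rw [Matrix.isUnit_iff_isUnit_det, isUnit_iff_ne_zero, Wp_eq]
  simp [Matrix.det_succ_row_zero, Fin.sum_univ_succ, Fin.succAbove, h0]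

/-- The adjoints of `U𝔭`, `U𝔭̄` and `U_p = U𝔭·U𝔭̄` with respect to the Poincaré
pairing are obtained by conjugation by the Atkin–Lehner matrix `ω_p = ω𝔭·ω𝔭̄`:
`U𝔭·ω_p = ω_p·U𝔭*`, `U𝔭̄·ω_p = ω_p·U𝔭̄*`, `(U𝔭·U𝔭̄)·ω_p = ω_p·U_p*`, and
equivalently `ω_p⁻¹·U𝔭·ω_p = U𝔭*`, `ω_p⁻¹·U𝔭̄·ω_p = U𝔭̄*`,
`ω_p⁻¹·(U𝔭·U𝔭̄)·ω_p = U_p*`, with the displayed starred matrices. -/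
theorem stmt_7 (p k : ℕ) (hp : p.Prime) (lp lpb : ℂ) :
    Ufp p k lp * Wp p k =
      Wp p k *
        !![0, -(-(p : ℂ)) ^ k, 0, 0;
           (-1 : ℂ) ^ k * (p : ℂ), lp, 0, 0;
           0, 0, 0, -(-(p : ℂ)) ^ k;
           0, 0, (-1 : ℂ) ^ k * (p : ℂ), lp] ∧
    Ufpb p k lpb * Wp p k =
      Wp p k *
        !![0, 0, -(-(p : ℂ)) ^ k, 0;
           0, 0, 0, -(-(p : ℂ)) ^ k;
           (-1 : ℂ) ^ k * (p : ℂ), 0, lpb, 0;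
           0, (-1 : ℂ) ^ k * (p : ℂ), 0, lpb] ∧
    (Ufp p k lp * Ufpb p k lpb) * Wp p k =
      Wp p k *
        !![0, 0, 0, (p : ℂ) ^ (2 * k);
           0, 0, -(p : ℂ) ^ (k + 1), (-1 : ℂ) ^ (k + 1) * (p : ℂ) ^ k * lp;
           0, -(p : ℂ) ^ (k + 1), 0, (-1 : ℂ) ^ (k + 1) * (p : ℂ) ^ k * lpb;
           (p : ℂ) ^ 2, (-1 : ℂ) ^ k * (p : ℂ) * lp, (-1 : ℂ) ^ k * (p : ℂ) * lpb, lp * lpb] ∧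
    (Wp p k)⁻¹ * Ufp p k lp * Wp p k =
      !![0, -(-(p : ℂ)) ^ k, 0, 0;
         (-1 : ℂ) ^ k * (p : ℂ), lp, 0, 0;
         0, 0, 0, -(-(p : ℂ)) ^ k;
         0, 0, (-1 : ℂ) ^ k * (p : ℂ), lp] ∧
    (Wp p k)⁻¹ * Ufpb p k lpb * Wp p k =
      !![0, 0, -(-(p : ℂ)) ^ k, 0;
         0, 0, 0, -(-(p : ℂ)) ^ k;
         (-1 : ℂ) ^ k * (p : ℂ), 0, lpb, 0;
         0, (-1 : ℂ) ^ k * (p : ℂ), 0, lpb] ∧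
    (Wp p k)⁻¹ * (Ufp p k lp * Ufpb p k lpb) * Wp p k =
      !![0, 0, 0, (p : ℂ) ^ (2 * k);
         0, 0, -(p : ℂ) ^ (k + 1), (-1 : ℂ) ^ (k + 1) * (p : ℂ) ^ k * lp;
         0, -(p : ℂ) ^ (k + 1), 0, (-1 : ℂ) ^ (k + 1) * (p : ℂ) ^ k * lpb;
         (p : ℂ) ^ 2, (-1 : ℂ) ^ k * (p : ℂ) * lp, (-1 : ℂ) ^ k * (p : ℂ) * lpb, lp * lpb] := by
  have hpow : (-(p : ℂ)) ^ k = (-1 : ℂ) ^ k * (p : ℂ) ^ k := neg_pow _ _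
  have hinv : Invertible (Wp p k) := (isUnit_Wp p k hp).invertible
  have key : ∀ A B : Matrix (Fin 4) (Fin 4) ℂ, A * Wp p k = Wp p k * B →
      (Wp p k)⁻¹ * A * Wp p k = B := fun A B h => by
    rw [Matrix.mul_assoc, h, Matrix.inv_mul_cancel_left_of_invertible]
  refine (fun h => ⟨h.1, h.2.1, h.2.2, key _ _ h.1, key _ _ h.2.1, key _ _ h.2.2⟩)
    (⟨?_, ?_, ?_⟩ : _ ∧ _ ∧ _)
  all_goals
    rw [Wp_eq]
    have he := neg_one_pow_mul_self k
    simp only [Ufp, Ufpb, hpow, pow_succ (p : ℂ) k, pow_succ (-1 : ℂ) k, two_mul, pow_add]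
    generalize (-1 : ℂ) ^ k = e at *
    generalize (p : ℂ) ^ k = P at *
    ext i j
    fin_cases i <;> fin_cases j <;>
      simp [Matrix.mul_apply, Fin.sum_univ_four] <;> grind
end

section
/- With notation and hypotheses as in the context, B(e₀, e₁) = B(e₁, e₀) = (λ𝔭/(εp+1))·c and B(e₀, e₂) = B(e₂, e₀) = (λ𝔭̄/(εp+1))·c. -/
open Matrix

/-- The adjoint `U𝔭* = ω_p⁻¹·U𝔭·ω_p`. -/
noncomputable def UfpStar (p k : ℕ) (lp : ℂ) : Matrix (Fin 4) (Fin 4) ℂ :=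
  (Wp p k)⁻¹ * Ufp p k lp * Wp p k

/-- The adjoint `U𝔭̄* = ω_p⁻¹·U𝔭̄·ω_p`. -/
noncomputable def UfpbStar (p k : ℕ) (lpb : ℂ) : Matrix (Fin 4) (Fin 4) ℂ :=
  (Wp p k)⁻¹ * Ufpb p k lpb * Wp p k

/-- The standard basis `e₀, e₁, e₂, e₃` of `ℂ⁴`. -/
noncomputable def e (i : Fin 4) : Fin 4 → ℂ := Pi.single i 1

lemma isUnit_det_Wp {p : ℕ} (k : ℕ) (hp : p ≠ 0) : IsUnit (Wp p k).det := by
  have hpk : (p : ℂ) ^ k ≠ 0 := pow_ne_zero _ (Nat.cast_ne_zero.mpr hp)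
  have hε : (-1 : ℂ) ^ k ≠ 0 := pow_ne_zero _ (by norm_num)
  rw [Wp, det_mul, isUnit_iff_ne_zero]
  refine mul_ne_zero ?_ ?_ <;>
    simp [Wfp, Wfpb, det_succ_row_zero, Fin.sum_univ_succ, Fin.succAbove, hp]

/-- To compute a conjugate `W⁻¹ U W` on a vector, it suffices to compare after applying `W`. -/
lemma inv_conj_mulVec_eq {n R : Type*} [Fintype n] [DecidableEq n] [CommRing R]
    {W U : Matrix n n R} (hW : IsUnit W.det) {x y : n → R}
    (h : U *ᵥ (W *ᵥ x) = W *ᵥ y) : (W⁻¹ * U * W) *ᵥ x = y := by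
  rw [← mulVec_mulVec, ← mulVec_mulVec, h, mulVec_mulVec, nonsing_inv_mul _ hW, one_mulVec]

lemma Ufp_mulVec_e_zero (p k : ℕ) (lp : ℂ) :
    Ufp p k lp *ᵥ e 0 = lp • e 0 + (-1 : ℂ) • e 1 := by
  ext i; fin_cases i <;> simp [Ufp, e]

lemma Ufpb_mulVec_e_zero (p k : ℕ) (lpb : ℂ) :
    Ufpb p k lpb *ᵥ e 0 = lpb • e 0 + (-1 : ℂ) • e 2 := by
  ext i; fin_cases i <;> simp [Ufpb, e]

lemma Wp_mulVec_e_zero (p k : ℕ) : Wp p k *ᵥ e 0 = e 3 := by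
  ext i
  fin_cases i <;> simp [Wp, Wfp, Wfpb, e, neg_one_pow_mul_self]

lemma Wp_mulVec_e_one (p k : ℕ) : Wp p k *ᵥ e 1 = ((-1 : ℂ) ^ k * (p : ℂ) ^ k) • e 2 := by
  ext i
  fin_cases i <;> simp [Wp, Wfp, Wfpb, e, mul_comm]

lemma Wp_mulVec_e_two (p k : ℕ) : Wp p k *ᵥ e 2 = ((-1 : ℂ) ^ k * (p : ℂ) ^ k) • e 1 := by
  ext i
  fin_cases i <;> simp [Wp, Wfp, Wfpb, e]

lemma Ufp_mulVec_e_three (p k : ℕ) (lp : ℂ) :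
    Ufp p k lp *ᵥ e 3 = (p : ℂ) ^ (k + 1) • e 2 := by
  ext i; fin_cases i <;> simp [Ufp, e]

lemma Ufpb_mulVec_e_three (p k : ℕ) (lpb : ℂ) :
    Ufpb p k lpb *ᵥ e 3 = (p : ℂ) ^ (k + 1) • e 1 := by
  ext i; fin_cases i <;> simp [Ufpb, e]

lemma UfpStar_mulVec_e_zero {p : ℕ} (k : ℕ) (hp : p ≠ 0) (lp : ℂ) :
    UfpStar p k lp *ᵥ e 0 = ((-1 : ℂ) ^ k * p) • e 1 := by
  refine inv_conj_mulVec_eq (isUnit_det_Wp k hp) ?_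
  rw [mulVec_smul, Wp_mulVec_e_zero, Wp_mulVec_e_one, Ufp_mulVec_e_three, smul_smul]
  congr 1
  linear_combination -(p : ℂ) ^ (k + 1) * neg_one_pow_mul_self k

lemma UfpbStar_mulVec_e_zero {p : ℕ} (k : ℕ) (hp : p ≠ 0) (lpb : ℂ) :
    UfpbStar p k lpb *ᵥ e 0 = ((-1 : ℂ) ^ k * p) • e 2 := by
  refine inv_conj_mulVec_eq (isUnit_det_Wp k hp) ?_
  rw [mulVec_smul, Wp_mulVec_e_zero, Wp_mulVec_e_two, Ufpb_mulVec_e_three, smul_smul]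
  congr 1
  linear_combination -(p : ℂ) ^ (k + 1) * neg_one_pow_mul_self k

lemma neg_one_pow_mul_natCast_sq_ne_one {p : ℕ} (k : ℕ) (hp : 2 ≤ p) :
    ((-1 : ℂ) ^ k * p) ^ 2 ≠ 1 := by
  rw [mul_pow, sq ((-1 : ℂ) ^ k), neg_one_pow_mul_self, one_mul]
  norm_cast
  nlinarith

/-- If `U v = l v - w` and `U* v = a w`, with `l` and `a` real and `a² ≠ 1`, then the adjunction
between `U` and `U*` determines the pairings of `v` and `w` in terms of `B v v`. -/
lemma pairing_eq_of_adjoint {V : Type*} [AddCommGroup V] [Module ℂ V] {B : V → V → ℂ}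
    (haddl : ∀ x x' y, B (x + x') y = B x y + B x' y)
    (haddr : ∀ x y y', B x (y + y') = B x y + B x y')
    (hsmull : ∀ (a : ℂ) (x y : V), B (a • x) y = a * B x y)
    (hsmulr : ∀ (a : ℂ) (x y : V), B x (a • y) = (starRingEnd ℂ) a * B x y)
    {v w : V} {l a : ℂ} (hl : (starRingEnd ℂ) l = l) (ha : (starRingEnd ℂ) a = a)
    (ha1 : a ^ 2 ≠ 1)
    (h : B (l • v + (-1 : ℂ) • w) v = B v (a • w))
    (h' : B (a • w) v = B v (l • v + (-1 : ℂ) • w)) :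
    B v w = l / (a + 1) * B v v ∧ B w v = l / (a + 1) * B v v := by
  simp only [haddl, haddr, hsmull, hsmulr, hl, ha, map_neg, map_one] at h h'
  have hplus : a + 1 ≠ 0 := fun h0 => ha1 (by linear_combination (a - 1) * h0)
  have hminus : a - 1 ≠ 0 := fun h0 => ha1 (by linear_combination (a + 1) * h0)
  have hsymm : B w v = B v w := mul_left_cancel₀ hminus (by linear_combination h + h')
  rw [hsymm] at h ⊢
  have : B v w = l / (a + 1) * B v v := by
    field_simp
    linear_combination -h
  exact ⟨this, this⟩

/-- Values of the twisted Poincaré pairing: `B(e₀,e₁) = B(e₁,e₀) = (λ𝔭/(εp+1))·c`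
and `B(e₀,e₂) = B(e₂,e₀) = (λ𝔭̄/(εp+1))·c`, where `ε = (−1)^k` and `c = B(e₀,e₀)`. -/
theorem stmt_8 (p k : ℕ) (hp : p.Prime) (hp3 : 3 ≤ p) (lp lpb : ℝ)
    (B : (Fin 4 → ℂ) → (Fin 4 → ℂ) → ℂ)
    (haddl : ∀ x x' y, B (x + x') y = B x y + B x' y)
    (haddr : ∀ x y y', B x (y + y') = B x y + B x y')
    (hsmull : ∀ (a : ℂ) (x y : Fin 4 → ℂ), B (a • x) y = a * B x y)
    (hsmulr : ∀ (a : ℂ) (x y : Fin 4 → ℂ), B x (a • y) = (starRingEnd ℂ) a * B x y)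
    (hU : ∀ x y, B ((Ufp p k (lp : ℂ)).mulVec x) y = B x ((UfpStar p k (lp : ℂ)).mulVec y))
    (hUs : ∀ x y, B ((UfpStar p k (lp : ℂ)).mulVec x) y = B x ((Ufp p k (lp : ℂ)).mulVec y))
    (hV : ∀ x y, B ((Ufpb p k (lpb : ℂ)).mulVec x) y = B x ((UfpbStar p k (lpb : ℂ)).mulVec y))
    (hVs : ∀ x y, B ((UfpbStar p k (lpb : ℂ)).mulVec x) y = B x ((Ufpb p k (lpb : ℂ)).mulVec y))
    :
    B (e 0) (e 1) = ((lp : ℂ) / ((-1 : ℂ) ^ k * (p : ℂ) + 1)) * B (e 0) (e 0) ∧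
    B (e 1) (e 0) = ((lp : ℂ) / ((-1 : ℂ) ^ k * (p : ℂ) + 1)) * B (e 0) (e 0) ∧
    B (e 0) (e 2) = ((lpb : ℂ) / ((-1 : ℂ) ^ k * (p : ℂ) + 1)) * B (e 0) (e 0) ∧
    B (e 2) (e 0) = ((lpb : ℂ) / ((-1 : ℂ) ^ k * (p : ℂ) + 1)) * B (e 0) (e 0) := by
  have hp0 : p ≠ 0 := hp.ne_zero
  have ha : (starRingEnd ℂ) ((-1 : ℂ) ^ k * p) = (-1 : ℂ) ^ k * p := by simp
  have ha1 := neg_one_pow_mul_natCast_sq_ne_one k (hp3.trans' (by norm_num : 2 ≤ 3))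
  have h := hU (e 0) (e 0)
  have h' := hUs (e 0) (e 0)
  rw [Ufp_mulVec_e_zero, UfpStar_mulVec_e_zero k hp0] at h h'
  have g := hV (e 0) (e 0)
  have g' := hVs (e 0) (e 0)
  rw [Ufpb_mulVec_e_zero, UfpbStar_mulVec_e_zero k hp0] at g g'
  obtain ⟨h01, h10⟩ := pairing_eq_of_adjoint haddl haddr hsmull hsmulr
    (Complex.conj_ofReal lp) ha ha1 h h'
  obtain ⟨h02, h20⟩ := pairing_eq_of_adjoint haddl haddr hsmull hsmulr
    (Complex.conj_ofReal lpb) ha ha1 g g'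
  exact ⟨h01, h10, h02, h20⟩
end

section
/- Let p be a prime and let r, r' be real numbers with 0 ≤ r < r'. Then the difference v_p(⌊n/p^r⌋!) − v_p(⌊n/p^{r'}⌋!) tends to +∞ as the natural number n tends to infinity. -/
/-- Adding `p * m` to `b` increases the `p`-adic valuation of the factorial by at least `m`. -/
theorem padicValNat_factorial_add_le_of_add_mul_le {p : ℕ} [Fact p.Prime] {a b m : ℕ}
    (h : b + p * m ≤ a) :
    padicValNat p b.factorial + m ≤ padicValNat p a.factorial := by
  have hdvd : b.factorial * (p * m).factorial ∣ a.factorial :=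
    (Nat.factorial_mul_factorial_dvd_factorial_add b (p * m)).trans (Nat.factorial_dvd_factorial h)
  have hle := (padicValNat_dvd_iff_le (p := p) a.factorial_ne_zero).1
    (pow_padicValNat_dvd.trans hdvd)
  rw [padicValNat.mul b.factorial_ne_zero (p * m).factorial_ne_zero,
    padicValNat_factorial_mul] at hle
  omega

/-- For a prime `p` and real exponents `0 ≤ r < r'`, the difference
`v_p(⌊n/p^r⌋!) − v_p(⌊n/p^{r'}⌋!)` tends to `+∞` as `n → ∞`. -/
theorem stmt_17 (p : ℕ) (hp : p.Prime) (r r' : ℝ) (hr : 0 ≤ r) (hrr' : r < r') :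
    Filter.Tendsto
      (fun n : ℕ =>
        (padicValNat p (Nat.factorial ⌊(n : ℝ) / (p : ℝ) ^ r⌋₊) : ℤ) -
          (padicValNat p (Nat.factorial ⌊(n : ℝ) / (p : ℝ) ^ r'⌋₊) : ℤ))
      Filter.atTop Filter.atTop := by
  have : Fact p.Prime := ⟨hp⟩
  have hp1 : (1 : ℝ) < p := by exact_mod_cast hp.one_lt
  have hpos : 0 < (p : ℝ) ^ r := Real.rpow_pos_of_pos (by linarith) r
  have hlt : (p : ℝ) ^ r < (p : ℝ) ^ r' := Real.rpow_lt_rpow_of_exponent_lt hp1 hrr'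
  have hc : 0 < ((p : ℝ) ^ r)⁻¹ - ((p : ℝ) ^ r')⁻¹ := sub_pos.2 (inv_strictAnti₀ hpos hlt)
  have hlim := (tendsto_natCast_atTop_atTop (R := ℝ)).atTop_mul_const hc
  refine Filter.tendsto_atTop.2 fun M => ?_
  filter_upwards [hlim.eventually_ge_atTop ((p * M.toNat : ℕ) : ℝ)] with n hn
  have hfloor : ⌊(n : ℝ) / (p : ℝ) ^ r'⌋₊ + p * M.toNat ≤ ⌊(n : ℝ) / (p : ℝ) ^ r⌋₊ := by
    apply Nat.le_floor
    have hb : (⌊(n : ℝ) / (p : ℝ) ^ r'⌋₊ : ℝ) ≤ n / (p : ℝ) ^ r' :=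
      Nat.floor_le (div_nonneg n.cast_nonneg (hpos.trans hlt).le)
    rw [mul_sub, ← div_eq_mul_inv, ← div_eq_mul_inv] at hn
    rw [Nat.cast_add]
    linarith
  have hval := padicValNat_factorial_add_le_of_add_mul_le hfloor
  omega
end
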